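/- Let S be a (2,ω)-divisible Cu-semigroup satisfying (O5), (O6) and (O7), and let λ be a functional on the sub-Cu-semigroup S_soft of strongly soft elements. Then the map λ_soft: S → [0,∞] defined by λ_soft(x) := sup { λ(v) : v ∈ S_soft, v ≤ x } is a functional on S, that is, λ_soft is additive (λ_soft(x+y) = λ_soft(x)+λ_soft(y)), order-preserving, preserves suprema of increasing sequences, and λ_soft(0)=0. -/

import Mathlib

open Set

/-- The way-below relation: `x ≪ y` if for every increasing sequence with a
supremum dominating `y`, some term of the sequence dominates `x`. -/
def WayBelow {S : Type*} [Preorder S] (x y : S) : Prop :=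
  ∀ z : ℕ → S, Monotone z → ∀ s : S, IsLUB (Set.range z) s → y ≤ s → ∃ m : ℕ, x ≤ z m

/-- A Cu-semigroup: a positively ordered commutative monoid satisfying (O1)-(O4). -/
class CuSemigroup (S : Type*) extends AddCommMonoid S, PartialOrder S where
  zero_le : ∀ x : S, 0 ≤ x
  add_mono : ∀ {a b c d : S}, a ≤ b → c ≤ d → a + c ≤ b + d
  O1 : ∀ z : ℕ → S, Monotone z → ∃ s : S, IsLUB (Set.range z) s
  O2 : ∀ x : S, ∃ z : ℕ → S, (∀ n, WayBelow (z n) (z (n + 1))) ∧ IsLUB (Set.range z) x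
  O3 : ∀ {x' x y' y : S}, WayBelow x' x → WayBelow y' y → WayBelow (x' + y') (x + y)
  O4 : ∀ (x y : ℕ → S), Monotone x → Monotone y → ∀ sx sy : S,
      IsLUB (Set.range x) sx → IsLUB (Set.range y) sy →
      IsLUB (Set.range fun n => x n + y n) (sx + sy)

variable {S : Type*}

lemma CuSemigroup.nsmul_mono [CuSemigroup S] (x : S) : Monotone fun n : ℕ => n • x := by
  intro n m h
  obtain ⟨k, rfl⟩ := Nat.exists_eq_add_of_le h
  show n • x ≤ (n + k) • x
  rw [add_nsmul]
  calc n • x = n • x + 0 := by rw [add_zero]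
    _ ≤ n • x + k • x := CuSemigroup.add_mono le_rfl (CuSemigroup.zero_le _)

/-- `infty x` is the supremum of the increasing sequence `n • x`, i.e. `∞x`. -/
noncomputable def infty [CuSemigroup S] (x : S) : S :=
  (CuSemigroup.O1 (fun n : ℕ => n • x) (CuSemigroup.nsmul_mono x)).choose

lemma infty_isLUB [CuSemigroup S] (x : S) :
    IsLUB (Set.range fun n : ℕ => n • x) (infty x) :=
  (CuSemigroup.O1 (fun n : ℕ => n • x) (CuSemigroup.nsmul_mono x)).choose_spec

/-- An element is strongly soft if every `x' ≪ x` admits `t` with `x' + t ≪ x`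
and `x' ≪ ∞t`. -/
def StronglySoft [CuSemigroup S] (x : S) : Prop :=
  ∀ x' : S, WayBelow x' x → ∃ t : S, WayBelow (x' + t) x ∧ WayBelow x' (infty t)

def SatisfiesO5 (S : Type*) [CuSemigroup S] : Prop :=
  ∀ x' x y' y z : S, WayBelow x' x → WayBelow y' y → x + y ≤ z →
    ∃ c : S, WayBelow y' c ∧ x' + c ≤ z ∧ z ≤ x + c

def SatisfiesO6 (S : Type*) [CuSemigroup S] : Prop :=
  ∀ x' x y z : S, WayBelow x' x → WayBelow x (y + z) →
    ∃ v w : S, v ≤ x ∧ v ≤ y ∧ w ≤ x ∧ w ≤ z ∧ x' ≤ v + w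

def SatisfiesO7 (S : Type*) [CuSemigroup S] : Prop :=
  ∀ x' x y' y w : S, WayBelow x' x → x ≤ w → WayBelow y' y → y ≤ w →
    ∃ z : S, WayBelow x' z ∧ WayBelow y' z ∧ z ≤ w ∧ z ≤ x + y

def TwoOmegaDivisible (S : Type*) [CuSemigroup S] : Prop :=
  ∀ x' x : S, WayBelow x' x → ∃ y : S, 2 • y ≤ x ∧ x' ≤ infty y

def WeaklyCancellative (S : Type*) [CuSemigroup S] : Prop :=
  ∀ x y z : S, WayBelow (x + z) (y + z) → WayBelow x y

def Separative (S : Type*) [CuSemigroup S] : Prop :=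
  ∀ x y t : S, WayBelow (x + t) (y + t) → WayBelow t (infty x) → WayBelow t (infty y) →
    WayBelow x y

def LeftSoftSeparative (S : Type*) [CuSemigroup S] : Prop :=
  ∀ x y t : S, StronglySoft x → WayBelow (x + t) (y + t) → WayBelow t (infty x) →
    WayBelow t (infty y) → WayBelow x y

def AlmostUnperforated (S : Type*) [CuSemigroup S] : Prop :=
  ∀ x y : S, (∃ n : ℕ, 1 ≤ n ∧ (n + 1) • x ≤ n • y) → x ≤ y

def CountablyBased (S : Type*) [CuSemigroup S] : Prop :=
  ∃ D : Set S, D.Countable ∧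
    ∀ x : S, ∃ z : ℕ → S, Monotone z ∧ (∀ n, z n ∈ D) ∧ IsLUB (Set.range z) x

/-- `Lset x` is the set `L_x = { u' : u' ≪ u ≪ x for some strongly soft u }`. -/
def Lset [CuSemigroup S] (x : S) : Set S :=
  { u' | ∃ u : S, StronglySoft u ∧ WayBelow u' u ∧ WayBelow u x }

/-- A functional on a Cu-semigroup: a monoid morphism to `[0,∞]` preserving order
and suprema of increasing sequences. -/
structure CuFunctional (S : Type*) [CuSemigroup S] where
  toFun : S → ENNReal
  map_zero : toFun 0 = 0
  map_add : ∀ x y : S, toFun (x + y) = toFun x + toFun y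
  mono : ∀ x y : S, x ≤ y → toFun x ≤ toFun y
  map_sup : ∀ z : ℕ → S, Monotone z → ∀ s : S, IsLUB (Set.range z) s →
    toFun s = ⨆ n, toFun (z n)

/-- Predicate version: `f : S → [0,∞]` is a functional on `S`. -/
def IsCuFunctional [CuSemigroup S] (f : S → ENNReal) : Prop :=
  f 0 = 0 ∧ (∀ x y : S, f (x + y) = f x + f y) ∧ (∀ x y : S, x ≤ y → f x ≤ f y) ∧
  (∀ z : ℕ → S, Monotone z → ∀ s : S, IsLUB (Set.range z) s → f s = ⨆ n, f (z n))

/-- Least upper bound of `A` computed within the subset `T`. -/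
def IsLUBIn [CuSemigroup S] (T : Set S) (A : Set S) (s : S) : Prop :=
  s ∈ T ∧ s ∈ upperBounds A ∧ ∀ b ∈ T, b ∈ upperBounds A → s ≤ b

/-- The way-below relation computed within the subset `T`. -/
def WayBelowIn [CuSemigroup S] (T : Set S) (x y : S) : Prop :=
  ∀ z : ℕ → S, Monotone z → (∀ n, z n ∈ T) → ∀ s : S, IsLUBIn T (Set.range z) s → y ≤ s →
    ∃ m : ℕ, x ≤ z m

/-- `T` is a sub-Cu-semigroup of `S`: a submonoid which is itself a Cu-semigroup
for the inherited order, such that the inclusion preserves suprema of increasing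
sequences and the way-below relation. -/
structure IsSubCuSemigroup [CuSemigroup S] (T : Set S) : Prop where
  zero_mem : (0 : S) ∈ T
  add_mem : ∀ {x y : S}, x ∈ T → y ∈ T → x + y ∈ T
  o1 : ∀ z : ℕ → S, Monotone z → (∀ n, z n ∈ T) → ∃ s : S, IsLUBIn T (Set.range z) s
  o2 : ∀ x ∈ T, ∃ z : ℕ → S, (∀ n, z n ∈ T) ∧ (∀ n, WayBelowIn T (z n) (z (n + 1))) ∧
        IsLUBIn T (Set.range z) x
  o3 : ∀ {x' x y' y : S}, x' ∈ T → x ∈ T → y' ∈ T → y ∈ T →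
        WayBelowIn T x' x → WayBelowIn T y' y → WayBelowIn T (x' + y') (x + y)
  o4 : ∀ (x y : ℕ → S), Monotone x → Monotone y → (∀ n, x n ∈ T) → (∀ n, y n ∈ T) →
        ∀ sx sy : S, IsLUBIn T (Set.range x) sx → IsLUBIn T (Set.range y) sy →
        IsLUBIn T (Set.range fun n => x n + y n) (sx + sy)
  incl_sup : ∀ z : ℕ → S, Monotone z → (∀ n, z n ∈ T) → ∀ s : S,
        IsLUBIn T (Set.range z) s → IsLUB (Set.range z) s
  incl_wayBelow : ∀ {x y : S}, x ∈ T → y ∈ T → WayBelowIn T x y → WayBelow x y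

def SatisfiesO5In [CuSemigroup S] (T : Set S) : Prop :=
  ∀ x' x y' y z : S, x' ∈ T → x ∈ T → y' ∈ T → y ∈ T → z ∈ T →
    WayBelowIn T x' x → WayBelowIn T y' y → x + y ≤ z →
    ∃ c ∈ T, WayBelowIn T y' c ∧ x' + c ≤ z ∧ z ≤ x + c

def SatisfiesO6In [CuSemigroup S] (T : Set S) : Prop :=
  ∀ x' x y z : S, x' ∈ T → x ∈ T → y ∈ T → z ∈ T →
    WayBelowIn T x' x → WayBelowIn T x (y + z) →
    ∃ v ∈ T, ∃ w ∈ T, v ≤ x ∧ v ≤ y ∧ w ≤ x ∧ w ≤ z ∧ x' ≤ v + w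

def SatisfiesO7In [CuSemigroup S] (T : Set S) : Prop :=
  ∀ x' x y' y w : S, x' ∈ T → x ∈ T → y' ∈ T → y ∈ T → w ∈ T →
    WayBelowIn T x' x → x ≤ w → WayBelowIn T y' y → y ≤ w →
    ∃ z ∈ T, WayBelowIn T x' z ∧ WayBelowIn T y' z ∧ z ≤ w ∧ z ≤ x + y

/-- `f` is a functional on the sub-Cu-semigroup `T` (values off `T` are irrelevant). -/
def IsFunctionalOn [CuSemigroup S] (T : Set S) (f : S → ENNReal) : Prop :=
  f 0 = 0 ∧
  (∀ x ∈ T, ∀ y ∈ T, f (x + y) = f x + f y) ∧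
  (∀ x ∈ T, ∀ y ∈ T, x ≤ y → f x ≤ f y) ∧
  (∀ z : ℕ → S, Monotone z → (∀ n, z n ∈ T) → ∀ s : S, IsLUBIn T (Set.range z) s →
    f s = ⨆ n, f (z n))

/-- An element is full if `x ≤ ∞e` for every `x`. -/
def IsFull [CuSemigroup S] (e : S) : Prop := ∀ x : S, x ≤ infty e

/-- Condition (R1) for `r`: comparison of `x` with `y` whenever
`λ(x) + r·λ(e) ≤ λ(y)` for all functionals. -/
def SatisfiesR1 (S : Type*) [CuSemigroup S] (e : S) (r : NNReal) : Prop :=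
  ∀ x y : S,
    (∀ lam : CuFunctional S, lam.toFun x + (r : ENNReal) * lam.toFun e ≤ lam.toFun y) → x ≤ y

/-- The radius of comparison of `(S, e)`. -/
noncomputable def rc (S : Type*) [CuSemigroup S] (e : S) : ENNReal :=
  ⨅ r ∈ {r : NNReal | 0 < r ∧ SatisfiesR1 S e r}, (r : ENNReal)

/-- Condition (R1) for the sub-Cu-semigroup `T`. -/
def SatisfiesR1On [CuSemigroup S] (T : Set S) (e : S) (r : NNReal) : Prop :=
  ∀ x ∈ T, ∀ y ∈ T,
    (∀ f : S → ENNReal, IsFunctionalOn T f → f x + (r : ENNReal) * f e ≤ f y) → x ≤ y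

/-- The radius of comparison of `(T, e)` for a sub-Cu-semigroup `T ⊆ S`. -/
noncomputable def rcOn [CuSemigroup S] (T : Set S) (e : S) : ENNReal :=
  ⨅ r ∈ {r : NNReal | 0 < r ∧ SatisfiesR1On T e r}, (r : ENNReal)

/-- `dim S ≤ n` in the sense of covering dimension of Cu-semigroups. -/
def DimLe (S : Type*) [CuSemigroup S] (n : ℕ) : Prop :=
  ∀ (x' x : S) (r : ℕ) (y : Fin r → S), WayBelow x' x → WayBelow x (∑ j, y j) →
    ∃ z : Fin r → Fin (n + 1) → S,
      (∀ j k, WayBelow (z j k) (y j)) ∧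
      WayBelow x' (∑ j, ∑ k, z j k) ∧
      (∀ k, WayBelow (∑ j, z j k) x)

/-- The covering dimension of a Cu-semigroup, in `ℕ ∪ {∞}`. -/
noncomputable def cuDim (S : Type*) [CuSemigroup S] : ℕ∞ :=
  ⨅ n ∈ {n : ℕ | DimLe S n}, (n : ℕ∞)

/-- `dim T ≤ n` for a sub-Cu-semigroup `T ⊆ S`. -/
def DimLeOn [CuSemigroup S] (T : Set S) (n : ℕ) : Prop :=
  ∀ (x' x : S), x' ∈ T → x ∈ T → ∀ (r : ℕ) (y : Fin r → S), (∀ j, y j ∈ T) →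
    WayBelowIn T x' x → WayBelowIn T x (∑ j, y j) →
    ∃ z : Fin r → Fin (n + 1) → S,
      (∀ j k, z j k ∈ T) ∧
      (∀ j k, WayBelowIn T (z j k) (y j)) ∧
      WayBelowIn T x' (∑ j, ∑ k, z j k) ∧
      (∀ k, WayBelowIn T (∑ j, z j k) x)

/-- The covering dimension of a sub-Cu-semigroup `T ⊆ S`. -/
noncomputable def cuDimOn [CuSemigroup S] (T : Set S) : ℕ∞ :=
  ⨅ n ∈ {n : ℕ | DimLeOn T n}, (n : ℕ∞)

open Filter Topology

instance CuSemigroup.isOrderedAddMonoid [CuSemigroup S] : IsOrderedAddMonoid S where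
  add_le_add_left _ _ h _ := CuSemigroup.add_mono h le_rfl

lemma CuSemigroup.le_self_add [CuSemigroup S] (a b : S) : a ≤ a + b :=
  le_add_of_nonneg_right (CuSemigroup.zero_le b)

lemma CuSemigroup.le_add_self [CuSemigroup S] (a b : S) : b ≤ a + b :=
  le_add_of_nonneg_left (CuSemigroup.zero_le a)

section WayBelow

variable [CuSemigroup S]

lemma WayBelow.le {x y : S} (h : WayBelow x y) : x ≤ y := by
  obtain ⟨m, hm⟩ := h (fun _ => y) monotone_const y (by simp) le_rfl
  exact hm

lemma WayBelow.trans_le {x y z : S} (h : WayBelow x y) (hyz : y ≤ z) : WayBelow x z :=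
  fun w hw s hs hz => h w hw s hs (hyz.trans hz)

lemma WayBelow.le_trans {x y z : S} (hxy : x ≤ y) (h : WayBelow y z) : WayBelow x z :=
  fun w hw s hs hz => (h w hw s hs hz).imp fun _ => hxy.trans

lemma wayBelow_zero (x : S) : WayBelow 0 x :=
  fun _ _ _ _ _ => ⟨0, CuSemigroup.zero_le _⟩

/-- Every element is the supremum of an increasing sequence of elements way below it. -/
lemma exists_wayBelow_isLUB (x : S) : ∃ z : ℕ → S, Monotone z ∧
    (∀ n, WayBelow (z n) (z (n + 1))) ∧ (∀ n, WayBelow (z n) x) ∧ IsLUB (Set.range z) x := by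
  obtain ⟨z, hz, hlub⟩ := CuSemigroup.O2 x
  exact ⟨z, monotone_nat_of_le_succ fun n => (hz n).le, hz,
    fun n => (hz n).trans_le (hlub.1 ⟨n + 1, rfl⟩), hlub⟩

lemma WayBelow.interpolate {x y : S} (h : WayBelow x y) :
    ∃ z, WayBelow x z ∧ WayBelow z y := by
  obtain ⟨z, hz, hstep, hzy, hlub⟩ := exists_wayBelow_isLUB y
  obtain ⟨m, hm⟩ := h z hz y hlub le_rfl
  exact ⟨z (m + 1), WayBelow.le_trans hm (hstep m), hzy _⟩

lemma WayBelow.exists_le_add {u x y : S} (h : WayBelow u (x + y)) :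
    ∃ x' y', WayBelow x' x ∧ WayBelow y' y ∧ u ≤ x' + y' := by
  obtain ⟨a, ha, -, hax, hal⟩ := exists_wayBelow_isLUB x
  obtain ⟨b, hb, -, hby, hbl⟩ := exists_wayBelow_isLUB y
  obtain ⟨m, hm⟩ := h (fun n => a n + b n) (ha.add hb) _ (CuSemigroup.O4 a b ha hb x y hal hbl)
    le_rfl
  exact ⟨a m, b m, hax m, hby m, hm⟩

end WayBelow

section Infty

variable [CuSemigroup S]

lemma nsmul_le_infty (n : ℕ) (x : S) : n • x ≤ infty x :=
  (infty_isLUB x).1 ⟨n, rfl⟩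

lemma le_infty (x : S) : x ≤ infty x := by
  simpa using nsmul_le_infty 1 x

lemma infty_add_infty_le (x : S) : infty x + infty x ≤ infty x := by
  refine (CuSemigroup.O4 _ _ (CuSemigroup.nsmul_mono x) (CuSemigroup.nsmul_mono x) _ _
    (infty_isLUB x) (infty_isLUB x)).2 ?_
  rintro _ ⟨n, rfl⟩
  simpa only [← add_nsmul] using nsmul_le_infty (n + n) x

lemma add_le_infty {a b c : S} (ha : a ≤ infty c) (hb : b ≤ infty c) : a + b ≤ infty c :=
  (add_le_add ha hb).trans (infty_add_infty_le c)

lemma infty_le_infty {x y : S} (h : x ≤ infty y) : infty x ≤ infty y := by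
  refine (infty_isLUB x).2 ?_
  rintro _ ⟨n, rfl⟩
  induction n with
  | zero => simpa using CuSemigroup.zero_le (infty y)
  | succ n ih => simpa only [succ_nsmul] using add_le_infty ih h

lemma isLUB_nsmul {z : ℕ → S} (hz : Monotone z) {c : S} (hc : IsLUB (Set.range z) c) (n : ℕ) :
    IsLUB (Set.range fun k => n • z k) (n • c) := by
  induction n with
  | zero => simp
  | succ n ih =>
    simpa only [succ_nsmul] using
      CuSemigroup.O4 _ z (fun i j h => nsmul_le_nsmul_right (hz h) n) hz _ _ ih hc

lemma WayBelow.exists_infty {a b c : S} (h : WayBelow a b) (hbc : b ≤ infty c) :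
    ∃ c', WayBelow c' c ∧ WayBelow a (infty c') := by
  obtain ⟨a₁, ha₁, h₁⟩ := h.interpolate
  obtain ⟨a₂, ha₂, h₂⟩ := h₁.interpolate
  obtain ⟨n, hn⟩ := h₂ _ (CuSemigroup.nsmul_mono c) _ (infty_isLUB c) hbc
  obtain ⟨z, hz, -, hzc, hlub⟩ := exists_wayBelow_isLUB c
  obtain ⟨k, hk⟩ := ha₂ _ (fun i j h => nsmul_le_nsmul_right (hz h) n) _ (isLUB_nsmul hz hlub n) hn
  exact ⟨z k, hzc k, ha₁.trans_le (hk.trans (nsmul_le_infty n _))⟩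

end Infty

section Soft

variable [CuSemigroup S]

lemma StronglySoft.zero : StronglySoft (0 : S) := by
  intro x hx
  refine ⟨0, by simpa using hx, hx.trans_le (CuSemigroup.zero_le _)⟩

lemma StronglySoft.add {v w : S} (hv : StronglySoft v) (hw : StronglySoft w) :
    StronglySoft (v + w) := by
  intro z hz
  obtain ⟨z₁, hz₁, hz₁vw⟩ := hz.interpolate
  obtain ⟨v', w', hv', hw', hle⟩ := hz₁vw.exists_le_add
  obtain ⟨s, hs, hvs⟩ := hv v' hv'
  obtain ⟨t, ht, hwt⟩ := hw w' hw'
  refine ⟨s + t, ?_, hz₁.trans_le (hle.trans (add_le_infty (hvs.le.trans ?_) (hwt.le.trans ?_)))⟩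
  · refine WayBelow.le_trans ?_ (CuSemigroup.O3 hs ht)
    rw [add_add_add_comm]
    exact add_le_add_left (hz₁.le.trans hle) _
  · exact infty_le_infty ((CuSemigroup.le_self_add s t).trans (le_infty _))
  · exact infty_le_infty ((CuSemigroup.le_add_self s t).trans (le_infty _))

lemma StronglySoft.nsmul {v : S} (hv : StronglySoft v) (n : ℕ) : StronglySoft (n • v) := by
  induction n with
  | zero => simpa using StronglySoft.zero
  | succ n ih => simpa only [succ_nsmul] using ih.add hv

/-- A strongly soft element absorbs the elements of the ideal it generates. -/
lemma StronglySoft.add_of_le_infty {b s : S} (hs : StronglySoft s) (hb : b ≤ infty s) :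
    StronglySoft (b + s) := by
  intro z hz
  obtain ⟨z₁, hz₁, hz₁bs⟩ := hz.interpolate
  obtain ⟨b', r₁, hb', hr₁, hle⟩ := hz₁bs.exists_le_add
  obtain ⟨r₂, hr₂, hbr₂⟩ := hb'.exists_infty hb
  obtain ⟨q, hq, -, hqs, hlub⟩ := exists_wayBelow_isLUB s
  obtain ⟨m₁, hm₁⟩ := hr₁ q hq s hlub le_rfl
  obtain ⟨m₂, hm₂⟩ := hr₂ q hq s hlub le_rfl
  obtain ⟨t, ht, hrt⟩ := hs (q (max m₁ m₂)) (hqs _)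
  have h₁ : r₁ ≤ q (max m₁ m₂) := hm₁.trans (hq (le_max_left _ _))
  have h₂ : r₂ ≤ q (max m₁ m₂) := hm₂.trans (hq (le_max_right _ _))
  refine ⟨t, ?_, hz₁.trans_le (hle.trans (add_le_infty ?_ (h₁.trans hrt.le)))⟩
  · refine WayBelow.le_trans ?_ (CuSemigroup.O3 hb' ht)
    rw [← add_assoc]
    exact add_le_add_left ((hz₁.le.trans hle).trans (add_le_add_right h₁ _)) _
  · exact hbr₂.le.trans (infty_le_infty (h₂.trans hrt.le))

/-- A series in which every term generates the ideal of the preceding ones is strongly soft. -/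
lemma stronglySoft_of_isLUB_sum {a : ℕ → S} (ha : ∀ n, a n ≤ infty (a (n + 1))) {s : S}
    (hs : IsLUB (Set.range fun m => ∑ k ∈ Finset.range m, a k) s) : StronglySoft s := by
  have hmono : Monotone fun m => ∑ k ∈ Finset.range m, a k :=
    monotone_nat_of_le_succ fun m => by
      rw [Finset.sum_range_succ]; exact CuSemigroup.le_self_add _ _
  have hsum : ∀ m, ∑ k ∈ Finset.range m, a k ≤ infty (a m) := by
    intro m
    induction m with
    | zero => simpa using CuSemigroup.zero_le (infty (a 0))
    | succ m ih =>
      rw [Finset.sum_range_succ]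
      exact add_le_infty (ih.trans (infty_le_infty (ha m))) (ha m)
  intro x hx
  obtain ⟨x₁, hx₁, hx₁s⟩ := hx.interpolate
  obtain ⟨m, hm⟩ := hx₁s _ hmono s hs le_rfl
  obtain ⟨t, ht, hxt⟩ := hx₁.exists_infty (hm.trans (hsum m))
  refine ⟨t, (CuSemigroup.O3 hx₁ ht).trans_le ?_, hxt⟩
  refine (add_le_add_left hm _).trans (hs.1 ⟨m + 1, ?_⟩)
  simp only [Finset.sum_range_succ]

end Soft

section Divisible

variable [CuSemigroup S]

lemma TwoOmegaDivisible.exists_wayBelow (hdiv : TwoOmegaDivisible S) {x' x : S}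
    (h : WayBelow x' x) :
    ∃ y' y, WayBelow y' y ∧ 2 • y ≤ x ∧ WayBelow x' (infty y') := by
  obtain ⟨x₁, hx₁, hx₁x⟩ := h.interpolate
  obtain ⟨y, hy, hx₁y⟩ := hdiv x₁ x hx₁x
  obtain ⟨y', hy', hxy'⟩ := hx₁.exists_infty hx₁y
  exact ⟨y', y, hy', hy, hxy'⟩

lemma TwoOmegaDivisible.exists_pow (hdiv : TwoOmegaDivisible S) (n : ℕ) {x' x : S}
    (h : WayBelow x' x) :
    ∃ y' y, WayBelow y' y ∧ 2 ^ n • y ≤ x ∧ x' ≤ infty y' := by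
  induction n generalizing x' x with
  | zero => exact ⟨x', x, h, by simp, le_infty x'⟩
  | succ n ih =>
    obtain ⟨y', y, hy', hy, hxy'⟩ := hdiv.exists_wayBelow h
    obtain ⟨w', w, hw', hw, hyw'⟩ := ih hy'
    refine ⟨w', w, hw', ?_, hxy'.le.trans (infty_le_infty hyw')⟩
    rw [pow_succ, mul_comm, mul_nsmul']
    exact (nsmul_le_nsmul_right hw 2).trans hy

lemma TwoOmegaDivisible.exists_stronglySoft (hdiv : TwoOmegaDivisible S) {x' x : S}
    (h : WayBelow x' x) : ∃ s, StronglySoft s ∧ s ≤ x ∧ x' ≤ infty s := by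
  choose g' g hg' hg hinf using
    fun p : {p : S × S // WayBelow p.1 p.2} => hdiv.exists_wayBelow p.2
  let P : ℕ → {p : S × S // WayBelow p.1 p.2} :=
    fun n => (fun p => ⟨(g' p, g p), hg' p⟩)^[n] ⟨(x', x), h⟩
  have hP : ∀ n, P (n + 1) = ⟨(g' (P n), g (P n)), hg' (P n)⟩ :=
    fun n => Function.iterate_succ_apply' _ _ _
  have htwo : ∀ n, 2 • (P (n + 1)).1.2 ≤ (P n).1.2 := fun n => by
    rw [hP]; exact hg (P n)
  have hideal : ∀ n, (P n).1.1 ≤ infty (P (n + 1)).1.1 := fun n => by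
    rw [hP]; exact (hinf (P n)).le
  have hbound : ∀ m, ∑ k ∈ Finset.range m, (P (k + 1)).1.1 + (P m).1.2 ≤ x := by
    intro m
    induction m with
    | zero => simp [P]
    | succ m ih =>
      refine le_trans ?_ ih
      rw [Finset.sum_range_succ, add_assoc]
      refine add_le_add_right (le_trans ?_ (htwo m)) _
      rw [two_nsmul]
      exact add_le_add_left (P (m + 1)).2.le _
  obtain ⟨s, hs⟩ := CuSemigroup.O1 (fun m => ∑ k ∈ Finset.range m, (P (k + 1)).1.1)
    (monotone_nat_of_le_succ fun m => by
      rw [Finset.sum_range_succ]; exact CuSemigroup.le_self_add _ _)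
  refine ⟨s, stronglySoft_of_isLUB_sum (fun n => hideal (n + 1)) hs, hs.2 ?_, ?_⟩
  · rintro _ ⟨m, rfl⟩
    exact (CuSemigroup.le_self_add _ _).trans (hbound m)
  · refine (hideal 0).trans (infty_le_infty (le_trans ?_ (le_infty s)))
    exact hs.1 ⟨1, by simp⟩

/-- Every strongly soft element is the supremum of an increasing sequence of strongly soft
elements way below it. -/
lemma StronglySoft.exists_isLUB (hdiv : TwoOmegaDivisible S) {u : S} (hu : StronglySoft u) :
    ∃ v : ℕ → S, Monotone v ∧ (∀ n, StronglySoft (v n)) ∧ (∀ n, WayBelow (v n) u) ∧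
      IsLUB (Set.range v) u := by
  have hbetween : ∀ x, WayBelow x u → ∃ v, StronglySoft v ∧ WayBelow v u ∧ x ≤ v := by
    intro x hx
    obtain ⟨x₁, hx₁, hx₁u⟩ := hx.interpolate
    obtain ⟨t, ht, hxt⟩ := hu x₁ hx₁u
    obtain ⟨t', ht', hxt'⟩ := hx₁.exists_infty hxt.le
    obtain ⟨s, hs, hst, hts⟩ := hdiv.exists_stronglySoft ht'
    exact ⟨x + s, hs.add_of_le_infty (hxt'.le.trans (infty_le_infty hts)),
      WayBelow.le_trans (add_le_add hx₁.le hst) ht, CuSemigroup.le_self_add _ _⟩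
  obtain ⟨z, hz, -, hzu, hlub⟩ := exists_wayBelow_isLUB u
  have hstep : ∀ (n : ℕ) (p : {v : S // StronglySoft v ∧ WayBelow v u}),
      ∃ q : {v : S // StronglySoft v ∧ WayBelow v u}, z n ≤ q ∧ (p : S) ≤ q := by
    rintro n ⟨p, -, hpu⟩
    obtain ⟨m, hm⟩ := hpu z hz u hlub le_rfl
    obtain ⟨v, hv, hvu, hle⟩ := hbetween (z (max n m)) (hzu _)
    exact ⟨⟨v, hv, hvu⟩, (hz (le_max_left _ _)).trans hle,
      hm.trans ((hz (le_max_right _ _)).trans hle)⟩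
  choose g hzg hg using hstep
  let v : ℕ → {v : S // StronglySoft v ∧ WayBelow v u} :=
    fun n => Nat.rec ⟨0, StronglySoft.zero, wayBelow_zero u⟩ g n
  refine ⟨fun n => (v n).1, monotone_nat_of_le_succ fun n => hg n (v n), fun n => (v n).2.1,
    fun n => (v n).2.2, ?_, fun b hb => hlub.2 ?_⟩
  · rintro _ ⟨n, rfl⟩
    exact (v n).2.2.le
  · rintro _ ⟨n, rfl⟩
    exact (hzg n (v n)).trans (hb ⟨n + 1, rfl⟩)

/-- Up to an arbitrarily small strongly soft summand, every element way below `x` is dominated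
by a strongly soft element below `x`. -/
lemma TwoOmegaDivisible.exists_stronglySoft_add (hdiv : TwoOmegaDivisible S)
    (hO5 : SatisfiesO5 S) (hO6 : SatisfiesO6 S) (n : ℕ) {x' x : S} (h : WayBelow x' x) :
    ∃ p q, StronglySoft p ∧ StronglySoft q ∧ p ≤ x ∧ 2 ^ n • q ≤ x ∧ x' ≤ p + q := by
  obtain ⟨x₁, hx₁, hx₁x⟩ := h.interpolate
  obtain ⟨y', y, hy', hy, hxy⟩ := hdiv.exists_pow (n + 1) hx₁x
  obtain ⟨y₁, hy₁, hy₁y⟩ := hy'.interpolate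
  obtain ⟨s, hs, hsy, hys⟩ := hdiv.exists_stronglySoft hy₁
  have hyx : y ≤ x :=
    le_trans (by simpa using CuSemigroup.nsmul_mono y Nat.one_le_two_pow) hy
  obtain ⟨c, -, hcx, hxc⟩ := hO5 y₁ y 0 0 x hy₁y (wayBelow_zero 0) (by simpa using hyx)
  obtain ⟨a, b, hax, hay, hbx, hbc, hle⟩ := hO6 x' x₁ y c hx₁ (hx₁x.trans_le hxc)
  have hxs : x₁ ≤ infty s := hxy.trans (infty_le_infty hys)
  refine ⟨b + s, a + s, hs.add_of_le_infty (hbx.trans hxs), hs.add_of_le_infty (hax.trans hxs),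
    ?_, ?_, ?_⟩
  · refine le_trans ?_ hcx
    rw [add_comm]
    exact add_le_add hsy hbc
  · refine le_trans ?_ hy
    rw [pow_succ, mul_nsmul', two_nsmul]
    exact nsmul_le_nsmul_right (add_le_add hay (hsy.trans hy₁y.le)) _
  · rw [add_comm a b] at hle
    exact hle.trans (add_le_add (CuSemigroup.le_self_add _ _) (CuSemigroup.le_self_add _ _))

end Divisible

section Functional

variable [CuSemigroup S] {f : S → ENNReal}

lemma IsFunctionalOn.map_nsmul (hf : IsFunctionalOn {x : S | StronglySoft x} f) {q : S}
    (hq : StronglySoft q) (n : ℕ) : f (n • q) = n * f q := by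
  induction n with
  | zero => simpa using hf.1
  | succ n ih => rw [succ_nsmul, hf.2.1 _ (hq.nsmul n) _ hq, ih]; push_cast; ring

lemma IsFunctionalOn.le_of_forall_wayBelow (hf : IsFunctionalOn {x : S | StronglySoft x} f)
    (hdiv : TwoOmegaDivisible S) {u : S} (hu : StronglySoft u) {C : ENNReal}
    (h : ∀ v, StronglySoft v → WayBelow v u → f v ≤ C) : f u ≤ C := by
  obtain ⟨v, hv, hvs, hvu, hlub⟩ := hu.exists_isLUB hdiv
  rw [hf.2.2.2 v hv hvs u ⟨hu, hlub.1, fun b _ hb => hlub.2 hb⟩]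
  exact iSup_le fun n => h _ (hvs n) (hvu n)

end Functional

lemma ENNReal.le_of_forall_le_add_mul_inv_two_pow {a b : ENNReal}
    (h : ∀ n : ℕ, a ≤ b + b * 2⁻¹ ^ n) : a ≤ b := by
  rcases eq_or_ne b ⊤ with rfl | hb
  · exact le_top
  have h0 : Tendsto (fun n : ℕ => b + b * (2⁻¹ : ENNReal) ^ n) atTop (𝓝 (b + b * 0)) :=
    (ENNReal.Tendsto.const_mul (ENNReal.tendsto_pow_atTop_nhds_zero_of_lt_one
      ENNReal.one_half_lt_one) (Or.inr hb)).const_add b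
  simpa using ge_of_tendsto' h0 h

/-- In a (2,ω)-divisible Cu-semigroup satisfying (O5)-(O7), for a
functional `λ` on the sub-Cu-semigroup of strongly soft elements, the map
`λ_soft(x) := sup { λ(v) : v strongly soft, v ≤ x }` is a functional on `S`. -/
theorem softified_functional {S : Type*} [CuSemigroup S]
    (hdiv : TwoOmegaDivisible S)
    (hO5 : SatisfiesO5 S) (hO6 : SatisfiesO6 S) (hO7 : SatisfiesO7 S)
    (f : S → ENNReal) (hf : IsFunctionalOn {x : S | StronglySoft x} f) :
    IsCuFunctional (fun x : S => ⨆ v ∈ {v : S | StronglySoft v ∧ v ≤ x}, f v) := by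
  set F : S → ENNReal := fun x => ⨆ v ∈ {v : S | StronglySoft v ∧ v ≤ x}, f v
  have le_F : ∀ {v x : S}, StronglySoft v → v ≤ x → f v ≤ F x := fun {v x} hv hvx =>
    le_iSup₂ (f := fun v (_ : v ∈ {v : S | StronglySoft v ∧ v ≤ x}) => f v) v ⟨hv, hvx⟩
  have F_mono : ∀ x y : S, x ≤ y → F x ≤ F y := fun x y hxy =>
    iSup₂_le fun v hv => le_F hv.1 (hv.2.trans hxy)
  have small : ∀ {q x : S} {n : ℕ}, StronglySoft q → 2 ^ n • q ≤ x → f q ≤ F x * 2⁻¹ ^ n := by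
    intro q x n hq hqx
    have h := le_F (hq.nsmul (2 ^ n)) hqx
    rw [hf.map_nsmul hq] at h
    rw [← ENNReal.inv_pow, ← div_eq_mul_inv, ENNReal.le_div_iff_mul_le (by simp) (by simp), mul_comm]
    simpa using h
  refine ⟨?_, fun x y => le_antisymm (iSup₂_le ?_) ?_, F_mono, fun z hz s hs => le_antisymm ?_ ?_⟩
  · refine le_antisymm (iSup₂_le fun v hv => ?_) bot_le
    rw [le_antisymm hv.2 (CuSemigroup.zero_le v), hf.1]
  · rintro u ⟨hu, huxy⟩
    refine hf.le_of_forall_wayBelow hdiv hu fun v hv hvu => ?_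
    obtain ⟨x', y', hx', hy', hle⟩ := (hvu.trans_le huxy).exists_le_add
    refine ENNReal.le_of_forall_le_add_mul_inv_two_pow fun n => ?_
    obtain ⟨p, q, hp, hq, hpx, hqx, hx'le⟩ := hdiv.exists_stronglySoft_add hO5 hO6 n hx'
    obtain ⟨r, t, hr, ht, hry, hty, hy'le⟩ := hdiv.exists_stronglySoft_add hO5 hO6 n hy'
    calc f v ≤ f ((p + q) + (r + t)) :=
          hf.2.2.1 _ hv _ ((hp.add hq).add (hr.add ht)) (hle.trans (add_le_add hx'le hy'le))
      _ = (f p + f q) + (f r + f t) := by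
          rw [hf.2.1 _ (hp.add hq) _ (hr.add ht), hf.2.1 _ hp _ hq, hf.2.1 _ hr _ ht]
      _ ≤ (F x + F x * 2⁻¹ ^ n) + (F y + F y * 2⁻¹ ^ n) :=
          add_le_add (add_le_add (le_F hp hpx) (small hq hqx))
            (add_le_add (le_F hr hry) (small ht hty))
      _ = (F x + F y) + (F x + F y) * 2⁻¹ ^ n := by ring
  · refine ENNReal.biSup_add_biSup_le' ⟨0, StronglySoft.zero, CuSemigroup.zero_le x⟩
      ⟨0, StronglySoft.zero, CuSemigroup.zero_le y⟩ fun v hv w hw => ?_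
    rw [← hf.2.1 v hv.1 w hw.1]
    exact le_F (hv.1.add hw.1) (add_le_add hv.2 hw.2)
  · refine iSup₂_le fun u hu => hf.le_of_forall_wayBelow hdiv hu.1 fun v hv hvu => ?_
    obtain ⟨m, hm⟩ := hvu z hz s hs hu.2
    exact (le_F hv hm).trans (le_iSup (fun n => F (z n)) m)
  · exact iSup_le fun n => F_mono _ _ (hs.1 ⟨n, rfl⟩)
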